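/- Let κ > 0, set α = (6+κ)/(2κ), β = κα²/2 = (6+κ)²/(8κ), and p = (6+κ)(2+κ)/(8κ). Then the function F(z,w) = (1−z)^α (1−w)^α (1−zw)^{−β} (principal-branch powers, well defined since 1−z, 1−w, 1−zw all have positive real part on 𝔻 × 𝔻) satisfies 𝒫(D)F = 0 on 𝔻 × 𝔻. (This is the analytic content of the theorem that the interior whole-plane SLE_κ map f₀ has E[(f₀'(z))^{p/2}] = (1−z)^α and E[|f₀'(z)|^p] = (1−z)^α(1−z̄)^α(1−zz̄)^{−β} for this special exponent p.) -/

import Mathlib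

open Complex Metric Set

/-- `z ∂_z` acting on functions of two complex variables. -/
noncomputable def dZ (F : ℂ → ℂ → ℂ) : ℂ → ℂ → ℂ :=
  fun z w => z * deriv (fun t => F t w) z

/-- `w ∂_w` acting on functions of two complex variables. -/
noncomputable def dW (F : ℂ → ℂ → ℂ) : ℂ → ℂ → ℂ :=
  fun z w => w * deriv (fun t => F z t) w

/-- The interior Beliaev–Smirnov operator `𝒫(D)`. -/
noncomputable def BSop (κ p : ℝ) (F : ℂ → ℂ → ℂ) : ℂ → ℂ → ℂ :=
  fun z w =>
    -((κ : ℂ)/2) * (dZ (fun u v => dZ F u v - dW F u v) z w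
        - dW (fun u v => dZ F u v - dW F u v) z w)
      + ((z + 1)/(z - 1)) * dZ F z w
      + ((w + 1)/(w - 1)) * dW F z w
      - (p : ℂ) * (1/(z - 1)^2 + 1/(w - 1)^2 - 2) * F z w

theorem one_sub_mem_slitPlane {z : ℂ} (hz : z ∈ ball (0 : ℂ) 1) : 1 - z ∈ slitPlane := by
  refine Or.inl ?_
  have h := (re_le_norm z).trans_lt (mem_ball_zero_iff.mp hz)
  simpa using h

theorem mul_mem_unit_ball {z w : ℂ} (hz : z ∈ ball (0 : ℂ) 1) (hw : w ∈ ball (0 : ℂ) 1) :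
    z * w ∈ ball (0 : ℂ) 1 := by
  rw [mem_ball_zero_iff] at *
  rw [norm_mul]
  exact mul_lt_one_of_nonneg_of_lt_one_left (norm_nonneg z) hz hw.le

/-- The function `(1 - z)^a (1 - w)^a (1 - zw)^(-b)`. -/
noncomputable def powerProduct (a b : ℂ) (z w : ℂ) : ℂ :=
  (1 - z) ^ a * (1 - w) ^ a * (1 - z * w) ^ (-b)

theorem powerProduct_comm (a b z w : ℂ) : powerProduct a b z w = powerProduct a b w z := by
  rw [powerProduct, powerProduct, mul_comm z w, mul_comm ((1 - z) ^ a)]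

theorem hasDerivAt_powerProduct_left (a b : ℂ) {z w : ℂ} (hz : z ∈ ball (0 : ℂ) 1)
    (hw : w ∈ ball (0 : ℂ) 1) :
    HasDerivAt (fun t => powerProduct a b t w)
      ((-a / (1 - z) + b * w / (1 - z * w)) * powerProduct a b z w) z := by
  have hz' := one_sub_mem_slitPlane hz
  have hzw' := one_sub_mem_slitPlane (mul_mem_unit_ball hz hw)
  have h1 : HasDerivAt (fun t : ℂ => (1 - t) ^ a) (a * (1 - z) ^ (a - 1) * -1) z :=
    ((hasDerivAt_id z).const_sub 1).cpow_const hz'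
  have h2 : HasDerivAt (fun t : ℂ => (1 - t * w) ^ (-b))
      (-b * (1 - z * w) ^ (-b - 1) * -(1 * w)) z :=
    (((hasDerivAt_id z).mul_const w).const_sub 1).cpow_const hzw'
  refine ((h1.mul_const ((1 - w) ^ a)).mul h2).congr_deriv ?_
  rw [cpow_sub _ _ (slitPlane_ne_zero hz'), cpow_sub _ _ (slitPlane_ne_zero hzw'), cpow_one,
    cpow_one, powerProduct]
  ring

theorem hasDerivAt_powerProduct_right (a b : ℂ) {z w : ℂ} (hz : z ∈ ball (0 : ℂ) 1)
    (hw : w ∈ ball (0 : ℂ) 1) :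
    HasDerivAt (fun t => powerProduct a b z t)
      ((-a / (1 - w) + b * z / (1 - z * w)) * powerProduct a b z w) w := by
  simpa only [powerProduct_comm a b z, mul_comm z w] using
    hasDerivAt_powerProduct_left a b hw hz

theorem dZ_powerProduct (a b : ℂ) {z w : ℂ} (hz : z ∈ ball (0 : ℂ) 1)
    (hw : w ∈ ball (0 : ℂ) 1) :
    dZ (powerProduct a b) z w
      = z * ((-a / (1 - z) + b * w / (1 - z * w)) * powerProduct a b z w) := by
  rw [dZ, (hasDerivAt_powerProduct_left a b hz hw).deriv]

theorem dW_powerProduct (a b : ℂ) {z w : ℂ} (hz : z ∈ ball (0 : ℂ) 1)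
    (hw : w ∈ ball (0 : ℂ) 1) :
    dW (powerProduct a b) z w
      = w * ((-a / (1 - w) + b * z / (1 - z * w)) * powerProduct a b z w) := by
  rw [dW, (hasDerivAt_powerProduct_right a b hz hw).deriv]

theorem dZ_sub_dW_powerProduct (a b : ℂ) {z w : ℂ} (hz : z ∈ ball (0 : ℂ) 1)
    (hw : w ∈ ball (0 : ℂ) 1) :
    dZ (powerProduct a b) z w - dW (powerProduct a b) z w
      = a * (w / (1 - w) - z / (1 - z)) * powerProduct a b z w := by
  rw [dZ_powerProduct a b hz hw, dW_powerProduct a b hz hw]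
  ring

theorem hasDerivAt_div_one_sub {z : ℂ} (hz : 1 - z ≠ 0) :
    HasDerivAt (fun t : ℂ => t / (1 - t)) (1 / (1 - z) ^ 2) z := by
  refine ((hasDerivAt_id z).div ((hasDerivAt_id z).const_sub 1) hz).congr_deriv ?_
  simp

theorem dZ_dZ_sub_dW_powerProduct (a b : ℂ) {z w : ℂ} (hz : z ∈ ball (0 : ℂ) 1)
    (hw : w ∈ ball (0 : ℂ) 1) :
    dZ (fun u v => dZ (powerProduct a b) u v - dW (powerProduct a b) u v) z w
      = z * (a * -(1 / (1 - z) ^ 2) * powerProduct a b z w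
        + a * (w / (1 - w) - z / (1 - z))
          * ((-a / (1 - z) + b * w / (1 - z * w)) * powerProduct a b z w)) := by
  have hd := (((hasDerivAt_div_one_sub
    (slitPlane_ne_zero (one_sub_mem_slitPlane hz))).const_sub (w / (1 - w))).const_mul a).mul
    (hasDerivAt_powerProduct_left a b hz hw)
  rw [dZ, (hd.congr_of_eventuallyEq ?_).deriv]
  filter_upwards [isOpen_ball.mem_nhds hz] with t ht
  exact dZ_sub_dW_powerProduct a b ht hw

theorem dW_dZ_sub_dW_powerProduct (a b : ℂ) {z w : ℂ} (hz : z ∈ ball (0 : ℂ) 1)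
    (hw : w ∈ ball (0 : ℂ) 1) :
    dW (fun u v => dZ (powerProduct a b) u v - dW (powerProduct a b) u v) z w
      = w * (a * (1 / (1 - w) ^ 2) * powerProduct a b z w
        + a * (w / (1 - w) - z / (1 - z))
          * ((-a / (1 - w) + b * z / (1 - z * w)) * powerProduct a b z w)) := by
  have hd := (((hasDerivAt_div_one_sub
    (slitPlane_ne_zero (one_sub_mem_slitPlane hw))).sub_const (z / (1 - z))).const_mul a).mul
    (hasDerivAt_powerProduct_right a b hz hw)
  rw [dW, (hd.congr_of_eventuallyEq ?_).deriv]
  filter_upwards [isOpen_ball.mem_nhds hw] with t ht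
  exact dZ_sub_dW_powerProduct a b hz ht

/-- For `κ > 0`, `α = (6+κ)/(2κ)`, `β = κα²/2 = (6+κ)²/(8κ)`, `p = (6+κ)(2+κ)/(8κ)`,
the function `F(z,w) = (1−z)^α (1−w)^α (1−zw)^{−β}` satisfies `𝒫(D)F = 0` on `𝔻 × 𝔻`. -/
theorem stmt3 (κ : ℝ) (hκ : 0 < κ) :
    let α : ℝ := (6 + κ)/(2*κ)
    let β : ℝ := κ * α^2/2
    let p : ℝ := (6 + κ)*(2 + κ)/(8*κ)
    let F : ℂ → ℂ → ℂ := fun u v =>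
      (1 - u) ^ (α : ℂ) * (1 - v) ^ (α : ℂ) * (1 - u*v) ^ (-(β : ℂ))
    ∀ z ∈ ball (0:ℂ) 1, ∀ w ∈ ball (0:ℂ) 1, BSop κ p F z w = 0 := by
  intro α β p F z hz w hw
  have hF : F = powerProduct (α : ℂ) (β : ℂ) := rfl
  have hκ' : (κ : ℂ) ≠ 0 := ofReal_ne_zero.mpr hκ.ne'
  have hz' := slitPlane_ne_zero (one_sub_mem_slitPlane hz)
  have hw' := slitPlane_ne_zero (one_sub_mem_slitPlane hw)
  have hzw' := slitPlane_ne_zero (one_sub_mem_slitPlane (mul_mem_unit_ball hz hw))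
  have hα : (α : ℂ) = (6 + κ) / (2 * κ) := by simp only [α]; push_cast; ring
  have hβ : (β : ℂ) = (6 + κ) ^ 2 / (8 * κ) := by
    simp only [β]; push_cast; rw [hα]; field_simp; ring
  have hp : (p : ℂ) = (6 + κ) * (2 + κ) / (8 * κ) := by simp only [p]; push_cast; ring
  rw [hF, BSop, dZ_dZ_sub_dW_powerProduct _ _ hz hw, dW_dZ_sub_dW_powerProduct _ _ hz hw,
    dZ_powerProduct _ _ hz hw, dW_powerProduct _ _ hz hw, hp]
  generalize powerProduct (α : ℂ) (β : ℂ) z w = P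
  rw [hα, hβ, ← neg_sub 1 z, ← neg_sub 1 w]
  field_simp
  ring
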